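/- Let p, q, n ≥ 1 and let H = K_{p,q} ∘_1 K_{1,n} with Laplacian matrix L, identified vertex u* ∈ P, parts P (|P| = p, u* ∈ P) and Q (|Q| = q), and set S of n pendant leaves attached to u*. Then for every matrix X with L·X·L = L, the quantity r(i,j) = X_{ii} + X_{jj} − X_{ij} − X_{ji} satisfies: r(u*, j) = 2/q for j ∈ P∖{u*}; r(u*, j) = (p+q−1)/(pq) for j ∈ Q; r(u*, j) = 1 for j ∈ S; r(i,j) = 2/q for distinct i, j ∈ P∖{u*}; r(i,j) = (p+q−1)/(pq) for i ∈ P∖{u*}, j ∈ Q; r(i,j) = (q+2)/q for i ∈ P∖{u*}, j ∈ S; r(i,j) = 2/p for distinct i, j ∈ Q; r(i,j) = (q(p+1)+(p−1))/(pq) for i ∈ Q, j ∈ S; r(i,j) = 2 for distinct i, j ∈ S. -/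

import Mathlib

open Matrix

-- The Laplacian matrix `L = D − A` of a finite simple graph, over `ℝ`.
open Classical in
noncomputable def lapMat {V : Type} [Fintype V] (G : SimpleGraph V) : Matrix V V ℝ :=
  Matrix.of fun i j =>
    if i = j then (Nat.card {v // G.Adj i v} : ℝ)
    else if G.Adj i j then -1 else 0

/-- Vertex set of `K_{p,q} ∘₁ K_{1,n}`: the identified vertex `u*`, the remaining
`p − 1` vertices of the part `P`, the part `Q` of size `q`, and the `n` pendant
leaves `S` attached to `u*`. -/
abbrev BSV (p' q n : ℕ) := Unit ⊕ (Fin p' ⊕ (Fin q ⊕ Fin n))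

/-- The graph `K_{p,q} ∘₁ K_{1,n}` (with `p' = p − 1`): every vertex of
`P = {u*} ∪ P'` is adjacent to every vertex of `Q`, each leaf of `S` is adjacent
only to `u*`, and there are no other edges. -/
def BipStarCoal (p' q n : ℕ) : SimpleGraph (BSV p' q n) :=
  SimpleGraph.fromRel (fun u v =>
    match u, v with
    | Sum.inl _, Sum.inr (Sum.inr _) => True                       -- u* – (Q ∪ S)
    | Sum.inr (Sum.inr _), Sum.inl _ => True
    | Sum.inr (Sum.inl _), Sum.inr (Sum.inr (Sum.inl _)) => True  -- P' – Q
    | Sum.inr (Sum.inr (Sum.inl _)), Sum.inr (Sum.inl _) => True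
    | _, _ => False)

theorem lapMat_mulVec_apply {V : Type} [Fintype V] (G : SimpleGraph V) [DecidableRel G.Adj]
    (y : V → ℝ) (v : V) :
    (lapMat G *ᵥ y) v = ∑ w, if G.Adj v w then y v - y w else 0 := by
  classical
  have hdeg : (Nat.card {w // G.Adj v w} : ℝ) * y v = ∑ w, if G.Adj v w then y v else 0 := by
    rw [Nat.card_eq_fintype_card, Fintype.card_subtype, ← Finset.sum_filter, Finset.sum_const,
      nsmul_eq_mul]
  have hterm : ∀ w, lapMat G v w * y w =
      (if v = w then (Nat.card {w // G.Adj v w} : ℝ) * y v else 0)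
        - (if G.Adj v w then y w else 0) := by
    intro w
    by_cases h : v = w
    · subst h
      simp [lapMat]
    · by_cases h' : G.Adj v w <;> simp [lapMat, h, h']
  simp only [Matrix.mulVec, dotProduct, hterm, Finset.sum_sub_distrib, Finset.sum_ite_eq,
    Finset.mem_univ, if_true]
  rw [hdeg, ← Finset.sum_sub_distrib]
  refine Finset.sum_congr rfl fun w _ => ?_
  split_ifs <;> simp

theorem lapMat_transpose {V : Type} [Fintype V] (G : SimpleGraph V) :
    (lapMat G)ᵀ = lapMat G := by
  ext i j
  by_cases h : i = j
  · subst h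
    rfl
  · by_cases h' : G.Adj i j
    · simp [lapMat, h, Ne.symm h, h', h'.symm]
    · simp [h', mt SimpleGraph.Adj.symm h', lapMat, h, Ne.symm h]

/-- If `y` is a potential for a unit current from `i` to `j`, then the resistance distance computed
from any `{1}`-inverse of a symmetric matrix `L` is the potential difference `y i - y j`. -/
theorem resistance_eq_potential_sub {V : Type} [Fintype V] [DecidableEq V]
    {L X : Matrix V V ℝ} (hL : Lᵀ = L) (hX : L * X * L = L) {y : V → ℝ} {i j : V}
    (hy : L *ᵥ y = Pi.single i 1 - Pi.single j 1) :
    X i i + X j j - X i j - X j i = y i - y j := by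
  have hy' : y ᵥ* L = Pi.single i 1 - Pi.single j 1 := by
    rw [← hy, ← Matrix.vecMul_transpose, hL]
  have h : y ⬝ᵥ ((L * X * L) *ᵥ y) = y ⬝ᵥ (L *ᵥ y) := by rw [hX]
  rw [← Matrix.mulVec_mulVec, ← Matrix.mulVec_mulVec, Matrix.dotProduct_mulVec, hy', hy] at h
  simp [Matrix.mulVec_sub, sub_dotProduct, dotProduct_sub] at h
  linarith

/-- A potential on `K_{p'+1,q} ∘₁ K_{1,n}` for a unit current from the first argument to `u*`. -/
noncomputable def bipStarPotential (p' q n : ℕ) : BSV p' q n → BSV p' q n → ℝ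
  | .inl _, _ => 0
  | .inr (.inl _), .inl _ => -1 / q
  | .inr (.inl a), .inr (.inl a') => if a' = a then 1 / q else 0
  | .inr (.inl _), .inr (.inr (.inl _)) => 0
  | .inr (.inl _), .inr (.inr (.inr _)) => -1 / q
  | .inr (.inr (.inl _)), .inl _ => -p' / ((p' + 1) * q)
  | .inr (.inr (.inl _)), .inr (.inl _) => 1 / ((p' + 1) * q)
  | .inr (.inr (.inl b)), .inr (.inr (.inl b')) => if b' = b then 1 / (p' + 1) else 0
  | .inr (.inr (.inl _)), .inr (.inr (.inr _)) => -p' / ((p' + 1) * q)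
  | .inr (.inr (.inr s)), .inr (.inr (.inr s')) => if s' = s then 1 else 0
  | .inr (.inr (.inr _)), _ => 0

theorem lapMat_mulVec_bipStarPotential (p' q n : ℕ) (hq : 1 ≤ q) (v : BSV p' q n) :
    lapMat (BipStarCoal p' q n) *ᵥ bipStarPotential p' q n v
      = Pi.single v 1 - Pi.single (Sum.inl ()) 1 := by
  classical
  have hq0 : (q : ℝ) ≠ 0 := by positivity
  have hp0 : (p' : ℝ) + 1 ≠ 0 := by positivity
  ext w
  rw [lapMat_mulVec_apply]
  rcases v with ⟨⟩ | a | b | s <;> rcases w with ⟨⟩ | a' | b' | s' <;>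
    simp [BipStarCoal, SimpleGraph.fromRel_adj, bipStarPotential, Fintype.sum_sum_type,
      Pi.single_apply, Finset.sum_sub_distrib]
  all_goals
    try split_ifs
    all_goals field_simp
    all_goals ring

theorem resistance_eq_bipStarPotential (p' q n : ℕ) (hq : 1 ≤ q)
    {X : Matrix (BSV p' q n) (BSV p' q n) ℝ}
    (hX : lapMat (BipStarCoal p' q n) * X * lapMat (BipStarCoal p' q n)
        = lapMat (BipStarCoal p' q n)) (i j : BSV p' q n) :
    X i i + X j j - X i j - X j i
      = (bipStarPotential p' q n i i - bipStarPotential p' q n j i)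
        - (bipStarPotential p' q n i j - bipStarPotential p' q n j j) := by
  classical
  refine resistance_eq_potential_sub (lapMat_transpose _) hX
    (y := bipStarPotential p' q n i - bipStarPotential p' q n j) ?_
  rw [Matrix.mulVec_sub, lapMat_mulVec_bipStarPotential p' q n hq,
    lapMat_mulVec_bipStarPotential p' q n hq]
  abel

/-- Resistance distances in `K_{p,q} ∘₁ K_{1,n}` (`p, q, n ≥ 1`). -/
theorem resistance_bipStarCoal (p q n : ℕ) (hp : 1 ≤ p) (hq : 1 ≤ q) (hn : 1 ≤ n)
    (X : Matrix (BSV (p - 1) q n) (BSV (p - 1) q n) ℝ)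
    (hX : lapMat (BipStarCoal (p - 1) q n) * X * lapMat (BipStarCoal (p - 1) q n)
        = lapMat (BipStarCoal (p - 1) q n)) :
    -- u* and a vertex of P∖{u*}
    (∀ j : Fin (p - 1),
      X (Sum.inl ()) (Sum.inl ()) + X (Sum.inr (Sum.inl j)) (Sum.inr (Sum.inl j))
        - X (Sum.inl ()) (Sum.inr (Sum.inl j)) - X (Sum.inr (Sum.inl j)) (Sum.inl ())
        = 2 / (q : ℝ)) ∧
    -- u* and a vertex of Q
    (∀ j : Fin q,
      X (Sum.inl ()) (Sum.inl ())
        + X (Sum.inr (Sum.inr (Sum.inl j))) (Sum.inr (Sum.inr (Sum.inl j)))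
        - X (Sum.inl ()) (Sum.inr (Sum.inr (Sum.inl j)))
        - X (Sum.inr (Sum.inr (Sum.inl j))) (Sum.inl ())
        = ((p : ℝ) + (q : ℝ) - 1) / ((p : ℝ) * (q : ℝ))) ∧
    -- u* and a leaf
    (∀ j : Fin n,
      X (Sum.inl ()) (Sum.inl ())
        + X (Sum.inr (Sum.inr (Sum.inr j))) (Sum.inr (Sum.inr (Sum.inr j)))
        - X (Sum.inl ()) (Sum.inr (Sum.inr (Sum.inr j)))
        - X (Sum.inr (Sum.inr (Sum.inr j))) (Sum.inl ()) = 1) ∧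
    -- two distinct vertices of P∖{u*}
    (∀ i j : Fin (p - 1), i ≠ j →
      X (Sum.inr (Sum.inl i)) (Sum.inr (Sum.inl i))
        + X (Sum.inr (Sum.inl j)) (Sum.inr (Sum.inl j))
        - X (Sum.inr (Sum.inl i)) (Sum.inr (Sum.inl j))
        - X (Sum.inr (Sum.inl j)) (Sum.inr (Sum.inl i)) = 2 / (q : ℝ)) ∧
    -- a vertex of P∖{u*} and a vertex of Q
    (∀ (i : Fin (p - 1)) (j : Fin q),
      X (Sum.inr (Sum.inl i)) (Sum.inr (Sum.inl i))
        + X (Sum.inr (Sum.inr (Sum.inl j))) (Sum.inr (Sum.inr (Sum.inl j)))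
        - X (Sum.inr (Sum.inl i)) (Sum.inr (Sum.inr (Sum.inl j)))
        - X (Sum.inr (Sum.inr (Sum.inl j))) (Sum.inr (Sum.inl i))
        = ((p : ℝ) + (q : ℝ) - 1) / ((p : ℝ) * (q : ℝ))) ∧
    -- a vertex of P∖{u*} and a leaf
    (∀ (i : Fin (p - 1)) (j : Fin n),
      X (Sum.inr (Sum.inl i)) (Sum.inr (Sum.inl i))
        + X (Sum.inr (Sum.inr (Sum.inr j))) (Sum.inr (Sum.inr (Sum.inr j)))
        - X (Sum.inr (Sum.inl i)) (Sum.inr (Sum.inr (Sum.inr j)))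
        - X (Sum.inr (Sum.inr (Sum.inr j))) (Sum.inr (Sum.inl i))
        = ((q : ℝ) + 2) / (q : ℝ)) ∧
    -- two distinct vertices of Q
    (∀ i j : Fin q, i ≠ j →
      X (Sum.inr (Sum.inr (Sum.inl i))) (Sum.inr (Sum.inr (Sum.inl i)))
        + X (Sum.inr (Sum.inr (Sum.inl j))) (Sum.inr (Sum.inr (Sum.inl j)))
        - X (Sum.inr (Sum.inr (Sum.inl i))) (Sum.inr (Sum.inr (Sum.inl j)))
        - X (Sum.inr (Sum.inr (Sum.inl j))) (Sum.inr (Sum.inr (Sum.inl i)))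
        = 2 / (p : ℝ)) ∧
    -- a vertex of Q and a leaf
    (∀ (i : Fin q) (j : Fin n),
      X (Sum.inr (Sum.inr (Sum.inl i))) (Sum.inr (Sum.inr (Sum.inl i)))
        + X (Sum.inr (Sum.inr (Sum.inr j))) (Sum.inr (Sum.inr (Sum.inr j)))
        - X (Sum.inr (Sum.inr (Sum.inl i))) (Sum.inr (Sum.inr (Sum.inr j)))
        - X (Sum.inr (Sum.inr (Sum.inr j))) (Sum.inr (Sum.inr (Sum.inl i)))
        = ((q : ℝ) * ((p : ℝ) + 1) + ((p : ℝ) - 1)) / ((p : ℝ) * (q : ℝ))) ∧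
    -- two distinct leaves
    (∀ i j : Fin n, i ≠ j →
      X (Sum.inr (Sum.inr (Sum.inr i))) (Sum.inr (Sum.inr (Sum.inr i)))
        + X (Sum.inr (Sum.inr (Sum.inr j))) (Sum.inr (Sum.inr (Sum.inr j)))
        - X (Sum.inr (Sum.inr (Sum.inr i))) (Sum.inr (Sum.inr (Sum.inr j)))
        - X (Sum.inr (Sum.inr (Sum.inr j))) (Sum.inr (Sum.inr (Sum.inr i))) = 2) := by
  obtain ⟨p', rfl⟩ : ∃ p', p = p' + 1 := ⟨p - 1, by omega⟩
  have hq0 : (q : ℝ) ≠ 0 := by positivity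
  have hp0 : (p' : ℝ) + 1 ≠ 0 := by positivity
  have r := resistance_eq_bipStarPotential p' q n hq hX
  refine ⟨fun j => ?_, fun j => ?_, fun j => ?_, fun i j hij => ?_, fun i j => ?_,
    fun i j => ?_, fun i j hij => ?_, fun i j => ?_, fun i j hij => ?_⟩ <;>
    refine (r _ _).trans ?_ <;>
    simp [bipStarPotential, *, Ne.symm]
  all_goals field_simp
  all_goals ring
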